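/- Let F be a field, Ω a quiver without cycles, and i a source or a sink of Ω. If there is no infinite sequence of indecomposable FLEI representations of S_i(Ω) over F connected by morphisms each of which is nonzero and not an isomorphism, then there is no such infinite sequence for Ω. -/

import Mathlib

/-- A quiver: a set of vertices, a set of arrows, with source and target maps. -/
structure Quiv : Type 1 where
  V : Type
  A : Type
  s : A → V
  t : A → V

/-- A representation of a quiver over a field `F`. -/
structure QRep (F : Type) [Field F] (Q : Quiv) : Type 1 where
  M : Q.V → Type
  [acg : ∀ i, AddCommGroup (M i)]
  [mod : ∀ i, Module F (M i)]
  map : ∀ a : Q.A, M (Q.s a) →ₗ[F] M (Q.t a)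

attribute [instance] QRep.acg QRep.mod

namespace QRep

variable {F : Type} [Field F] {Q : Quiv}

/-- A representation is nonzero if some vertex space has a nonzero vector. -/
def Nonzero (V : QRep F Q) : Prop := ∃ i, ∃ x : V.M i, x ≠ 0

/-- A morphism of representations. -/
structure Hom (V W : QRep F Q) : Type where
  app : ∀ i, V.M i →ₗ[F] W.M i
  comm : ∀ a : Q.A, (W.map a).comp (app (Q.s a)) = (app (Q.t a)).comp (V.map a)

/-- A morphism is an isomorphism iff it is bijective at each vertex. -/
def Hom.IsIso {V W : QRep F Q} (f : Hom V W) : Prop := ∀ i, Function.Bijective (f.app i)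

/-- Two representations are isomorphic. -/
def Iso (V W : QRep F Q) : Prop := ∃ f : Hom V W, f.IsIso

/-- The (external) direct sum of two representations. -/
def dsum (V W : QRep F Q) : QRep F Q where
  M i := V.M i × W.M i
  map a := (V.map a).prodMap (W.map a)

/-- A representation is indecomposable if it is nonzero and not isomorphic to a direct
sum of two nonzero representations. -/
def Indec (V : QRep F Q) : Prop :=
  V.Nonzero ∧ ∀ A B : QRep F Q, A.Nonzero → B.Nonzero → ¬ Iso V (dsum A B)

/-- FLEI: locally finite-dimensional, and all but finitely many arrow maps are
isomorphisms. -/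
def IsFLEI (V : QRep F Q) : Prop :=
  (∀ i, FiniteDimensional F (V.M i)) ∧ {a : Q.A | ¬ Function.Bijective (V.map a)}.Finite

end QRep

/-- A subrepresentation: a subspace at each vertex, stable under the arrow maps. -/
structure Subrep {F : Type} [Field F] {Q : Quiv} (V : QRep F Q) : Type where
  S : ∀ i, Submodule F (V.M i)
  stable : ∀ a : Q.A, ∀ x ∈ S (Q.s a), V.map a x ∈ S (Q.t a)

namespace Subrep

variable {F : Type} [Field F] {Q : Quiv} {V : QRep F Q}

/-- A subrepresentation, viewed as a representation in its own right. -/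
def toRep (W : Subrep V) : QRep F Q where
  M i := ↥(W.S i)
  map a := (V.map a).restrict (W.stable a)

/-- The quotient of a representation by a subrepresentation. -/
def quot (W : Subrep V) : QRep F Q where
  M i := V.M i ⧸ W.S i
  map a := Submodule.mapQ _ _ (V.map a) (fun x hx => W.stable a x hx)

end Subrep
/-- Adjacency in the underlying graph of a quiver. -/
def Quiv.Adj (Q : Quiv) (i j : Q.V) : Prop :=
  ∃ a : Q.A, (Q.s a = i ∧ Q.t a = j) ∨ (Q.s a = j ∧ Q.t a = i)

/-- The underlying graph is connected. -/
def Quiv.Connected (Q : Quiv) : Prop :=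
  ∀ i j : Q.V, Relation.ReflTransGen Q.Adj i j

/-- Source of an oriented edge-traversal (arrow plus direction of traversal). -/
def Quiv.esrc (Q : Quiv) (p : Q.A × Bool) : Q.V := if p.2 then Q.s p.1 else Q.t p.1

/-- Target of an oriented edge-traversal. -/
def Quiv.etgt (Q : Quiv) (p : Q.A × Bool) : Q.V := if p.2 then Q.t p.1 else Q.s p.1

/-- `e 0, …, e (n-1)` is a cycle: a closed walk of positive length in the underlying
graph traversing no edge twice. -/
def Quiv.IsCycle (Q : Quiv) (n : ℕ) (e : ℕ → Q.A × Bool) : Prop :=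
  0 < n ∧ (∀ k < n, Q.etgt (e k) = Q.esrc (e ((k + 1) % n))) ∧
    (∀ j < n, ∀ k < n, (e j).1 = (e k).1 → j = k)

/-- The quiver has no cycles in its underlying graph. -/
def Quiv.NoCycles (Q : Quiv) : Prop := ¬ ∃ (n : ℕ) (e : ℕ → Q.A × Bool), Q.IsCycle n e

/-- A tree quiver: connected underlying graph with no cycles. -/
def Quiv.IsTree (Q : Quiv) : Prop := Q.Connected ∧ Q.NoCycles
namespace QRep

variable {F : Type} [Field F] {Q : Quiv}

/-- A morphism is nonzero if it is nonzero at some vertex. -/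
def Hom.Nonzero {V W : QRep F Q} (f : Hom V W) : Prop := ∃ i, f.app i ≠ 0

/-- A morphism is injective if it is injective at every vertex. -/
def Hom.Injective {V W : QRep F Q} (f : Hom V W) : Prop :=
  ∀ i, Function.Injective (f.app i)

/-- A morphism is surjective if it is surjective at every vertex. -/
def Hom.Surjective {V W : QRep F Q} (f : Hom V W) : Prop :=
  ∀ i, Function.Surjective (f.app i)

end QRep
/-- A vertex is a sink if it is the source of no arrow. -/
def Quiv.IsSink (Q : Quiv) (i : Q.V) : Prop := ∀ a : Q.A, Q.s a ≠ i

/-- A vertex is a source if it is the target of no arrow. -/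
def Quiv.IsSource (Q : Quiv) (i : Q.V) : Prop := ∀ a : Q.A, Q.t a ≠ i

namespace QRep

open DirectSum

variable {F : Type} [Field F] {Q : Quiv}

/-- Transport of vertex spaces along an equality of vertices. -/
def castLE (V : QRep F Q) {j k : Q.V} (h : j = k) : V.M j ≃ₗ[F] V.M k := by
  subst h; exact LinearEquiv.refl F (V.M j)

open Classical in
/-- The canonical map `⊕_{a : t(a) = i} V(s(a)) → V(i)` given by `Σ_a V(a)`. -/
noncomputable def sumIn (V : QRep F Q) (i : Q.V) :
    (⨁ a : {a : Q.A // Q.t a = i}, V.M (Q.s a.1)) →ₗ[F] V.M i :=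
  DirectSum.toModule F _ _ (fun a => (V.castLE a.2).toLinearMap ∘ₗ V.map a.1)

/-- The canonical map `V(i) → Π_{a : s(a) = i} V(t(a))` with components `V(a)`. -/
def prodOut (V : QRep F Q) (i : Q.V) :
    V.M i →ₗ[F] ((a : {a : Q.A // Q.s a = i}) → V.M (Q.t a.1)) :=
  LinearMap.pi (fun a => V.map a.1 ∘ₗ (V.castLE a.2.symm).toLinearMap)

/-- `V` is isomorphic to the simple representation `L_i` (one-dimensional at `i`, zero
elsewhere, all arrow maps zero). -/
def IsoToL (V : QRep F Q) (i : Q.V) : Prop :=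
  Module.finrank F (V.M i) = 1 ∧ (∀ j, j ≠ i → ∀ x : V.M j, x = 0) ∧
    (∀ a : Q.A, V.map a = 0)

end QRep
open Classical in
/-- `S_i(Ω)`: the quiver `Ω` with all arrows incident to `i` reversed. -/
noncomputable def Sflip (Q : Quiv) (i : Q.V) : Quiv where
  V := Q.V
  A := Q.A
  s a := if Q.s a = i ∨ Q.t a = i then Q.t a else Q.s a
  t a := if Q.s a = i ∨ Q.t a = i then Q.s a else Q.t a

namespace QRep

variable {F : Type} [Field F] {Q : Quiv}

theorem Hom.comm_apply {V W : QRep F Q} (f : Hom V W) (a : Q.A) (x : V.M (Q.s a)) :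
    W.map a (f.app (Q.s a) x) = f.app (Q.t a) (V.map a x) :=
  LinearMap.congr_fun (f.comm a) x

/-- Every idempotent endomorphism of `V` is zero or the identity. -/
def IdemTrivial (V : QRep F Q) : Prop :=
  ∀ e : Hom V V, (∀ j x, e.app j (e.app j x) = e.app j x) →
    (∀ j x, e.app j x = 0) ∨ ∀ j x, e.app j x = x

theorem indec_iff (V : QRep F Q) : V.Indec ↔ V.Nonzero ∧ V.IdemTrivial := by
  refine and_congr_right fun _ => ⟨fun h e he => ?_, fun h A B hA hB => ?_⟩
  · by_contra! hcon
    obtain ⟨⟨j, x, hx⟩, k, y, hy⟩ := hcon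
    let A : Subrep V :=
      ⟨fun i => LinearMap.range (e.app i), by
        rintro a _ ⟨z, rfl⟩
        exact ⟨V.map a z, (e.comm_apply a z).symm⟩⟩
    let B : Subrep V :=
      ⟨fun i => LinearMap.ker (e.app i), by
        intro a z hz
        rw [LinearMap.mem_ker] at hz ⊢
        rw [← e.comm_apply a z, hz, map_zero]⟩
    refine h A.toRep B.toRep ⟨j, (⟨e.app j x, x, rfl⟩ : LinearMap.range (e.app j)), ?_⟩
      ⟨k, (⟨y - e.app k y, ?_⟩ : LinearMap.ker (e.app k)), ?_⟩ ⟨⟨fun i => ?_, fun a => ?_⟩, ?_⟩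
    · exact fun h0 => hx (congrArg Subtype.val h0)
    · rw [LinearMap.mem_ker, map_sub, he, sub_self]
    · exact fun h0 => hy (sub_eq_zero.mp (congrArg Subtype.val h0)).symm
    · exact LinearMap.prod (e.app i).rangeRestrict
        ((LinearMap.id - e.app i).codRestrict (LinearMap.ker (e.app i)) fun z => by
          rw [LinearMap.mem_ker, LinearMap.sub_apply, map_sub, LinearMap.id_apply, he, sub_self])
    · refine LinearMap.ext fun z => Prod.ext (Subtype.ext ?_) (Subtype.ext ?_)
      · exact e.comm_apply a z
      · change V.map a (z - e.app _ z) = V.map a z - e.app _ (V.map a z)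
        rw [map_sub, e.comm_apply]
    · refine fun i => ⟨fun z w hzw => ?_, fun p => ?_⟩
      · have h1 : e.app i z = e.app i w := congrArg (fun q => q.1.1) hzw
        have h2 : z - e.app i z = w - e.app i w := congrArg (fun q => q.2.1) hzw
        rw [h1] at h2
        exact sub_left_injective h2
      · obtain ⟨⟨_, z, rfl⟩, w, hw⟩ := p
        have hw' : e.app i w = 0 := hw
        refine ⟨e.app i z + w, Prod.ext (Subtype.ext ?_) (Subtype.ext ?_)⟩
        · change e.app i (e.app i z + w) = e.app i z
          rw [map_add, he, hw', add_zero]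
        · change e.app i z + w - e.app i (e.app i z + w) = w
          rw [map_add, he, hw', add_zero, add_sub_cancel_left]
  · rintro ⟨f, hf⟩
    let φ : ∀ i, V.M i ≃ₗ[F] A.M i × B.M i := fun i => LinearEquiv.ofBijective (f.app i) (hf i)
    have hφ : ∀ a x, (A.map a).prodMap (B.map a) (φ (Q.s a) x) = φ (Q.t a) (V.map a x) :=
      fun a x => f.comm_apply a x
    let e : Hom V V :=
      ⟨fun i => (φ i).symm.toLinearMap ∘ₗ (LinearMap.inl F _ _ ∘ₗ LinearMap.fst F _ _) ∘ₗ
          (φ i).toLinearMap, fun a => LinearMap.ext fun x => by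
        apply (φ (Q.t a)).injective
        have hx := hφ a x
        simp only [LinearMap.comp_apply, LinearEquiv.coe_coe, LinearEquiv.apply_symm_apply,
          ← hφ, LinearMap.prodMap_apply, LinearMap.inl_apply, LinearMap.fst_apply, map_zero]⟩
    have he : ∀ i x, e.app i x = (φ i).symm ((φ i x).1, 0) := fun _ _ => rfl
    rcases h e (fun j x => by simp [he]) with h0 | h1
    · obtain ⟨j, x, hx⟩ := hA
      have := h0 j ((φ j).symm (x, 0))
      rw [he, LinearEquiv.apply_symm_apply, LinearEquiv.map_eq_zero_iff] at this
      exact hx (congrArg Prod.fst this)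
    · obtain ⟨j, x, hx⟩ := hB
      have := h1 j ((φ j).symm (0, x))
      rw [he, LinearEquiv.apply_symm_apply] at this
      exact hx (congrArg Prod.snd ((φ j).symm.injective this)).symm

/-- There is an infinite sequence of indecomposable FLEI representations connected by nonzero
non-isomorphisms. -/
def HasChain (F : Type) [Field F] (Q : Quiv) : Prop :=
  ∃ (W : ℕ → QRep F Q) (f : ∀ n : ℕ, Hom (W n) (W (n + 1))),
    (∀ n, (W n).Indec ∧ (W n).IsFLEI) ∧ ∀ n, (f n).Nonzero ∧ ¬ (f n).IsIso

end QRep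

/-- An isomorphism of quivers. -/
structure Quiv.Equiv (Q Q' : Quiv) where
  v : Q.V ≃ Q'.V
  a : Q.A ≃ Q'.A
  s_eq : ∀ b, Q'.s (a b) = v (Q.s b)
  t_eq : ∀ b, Q'.t (a b) = v (Q.t b)

namespace QRep

variable {F : Type} [Field F] {Q Q' : Quiv}

theorem castLE_map {V W : QRep F Q} (f : Hom V W) {j k : Q.V} (h : j = k) (x : V.M j) :
    f.app k (V.castLE h x) = W.castLE h (f.app j x) := by
  subst h; rfl

/-- The pullback of a representation along an isomorphism of quivers. -/
def pull (E : Quiv.Equiv Q Q') (V : QRep F Q') : QRep F Q where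
  M j := V.M (E.v j)
  map b := (V.castLE (E.t_eq b)).toLinearMap ∘ₗ V.map (E.a b) ∘ₗ
    (V.castLE (E.s_eq b)).symm.toLinearMap

/-- The pullback of a morphism along an isomorphism of quivers. -/
def Hom.pull (E : Quiv.Equiv Q Q') {V W : QRep F Q'} (f : Hom V W) :
    Hom (V.pull E) (W.pull E) where
  app j := f.app (E.v j)
  comm b := LinearMap.ext fun x => by
    obtain ⟨y, rfl⟩ := (V.castLE (E.s_eq b)).surjective x
    change W.castLE _ (W.map _ ((W.castLE _).symm (f.app _ _))) =
      f.app _ (V.castLE _ (V.map _ ((V.castLE _).symm (V.castLE _ y))))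
    rw [castLE_map, castLE_map, LinearEquiv.symm_apply_apply, LinearEquiv.symm_apply_apply,
      f.comm_apply]

theorem exists_hom_of_pull (E : Quiv.Equiv Q Q') {V W : QRep F Q'}
    (g : Hom (V.pull E) (W.pull E)) : ∃ f : Hom V W, ∀ j, f.app (E.v j) = g.app j := by
  let φ : ∀ k, V.M k →ₗ[F] W.M k := fun k =>
    (W.castLE (E.v.apply_symm_apply k)).toLinearMap ∘ₗ g.app (E.v.symm k) ∘ₗ
      (V.castLE (E.v.apply_symm_apply k)).symm.toLinearMap
  have key : ∀ (j j' : Q.V) (h : E.v j' = E.v j) (h' : j' = j),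
      (W.castLE h).toLinearMap ∘ₗ g.app j' ∘ₗ (V.castLE h).symm.toLinearMap = g.app j := by
    rintro j _ h rfl
    rfl
  have hφ : ∀ j, φ (E.v j) = g.app j := fun j => key j _ _ (E.v.symm_apply_apply j)
  have hcast : ∀ {j k : Q'.V} (h : j = k) (x : V.M j),
      φ k (V.castLE h x) = W.castLE h (φ j x) := by
    rintro j _ rfl x
    rfl
  refine ⟨⟨φ, fun a => LinearMap.ext fun x => ?_⟩, hφ⟩
  obtain ⟨b, rfl⟩ := E.a.surjective a
  apply (W.castLE (E.t_eq b)).injective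
  have := g.comm_apply b (V.castLE (E.s_eq b) x)
  change W.castLE _ (W.map _ (φ _ x)) = W.castLE _ (φ _ (V.map _ x))
  rw [← hcast, hφ]
  change W.castLE _ (W.map _ ((W.castLE _).symm _)) =
    g.app _ (V.castLE _ (V.map _ ((V.castLE _).symm (V.castLE _ x)))) at this
  rw [LinearEquiv.symm_apply_apply] at this
  refine Eq.trans (congrArg (fun z => W.castLE _ (W.map _ z)) ?_) this
  refine ((LinearEquiv.symm_apply_eq (W.castLE (E.s_eq b))).mpr ?_).symm
  exact (LinearMap.congr_fun (hφ _) _).symm.trans (hcast _ _)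

theorem Indec.pull (E : Quiv.Equiv Q Q') {V : QRep F Q'} (hV : V.Indec) : (V.pull E).Indec := by
  rw [indec_iff] at hV ⊢
  obtain ⟨⟨k, x, hx⟩, h⟩ := hV
  obtain ⟨k, rfl⟩ := E.v.surjective k
  refine ⟨⟨k, x, hx⟩, fun e he => ?_⟩
  obtain ⟨f, hf⟩ := exists_hom_of_pull E e
  refine (h f fun k x => ?_).imp (fun h0 j x => ?_) (fun h1 j x => ?_)
  · obtain ⟨k, rfl⟩ := E.v.surjective k
    rw [hf]
    exact he k x
  · rw [← hf]
    exact h0 _ x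
  · rw [← hf]
    exact h1 _ x

theorem IsFLEI.pull (E : Quiv.Equiv Q Q') {V : QRep F Q'} (hV : V.IsFLEI) :
    (V.pull E).IsFLEI := by
  refine ⟨fun j => hV.1 _, (hV.2.preimage E.a.injective.injOn).subset fun b hb hbij => hb ?_⟩
  exact (V.castLE (E.t_eq b)).bijective.comp (hbij.comp (V.castLE (E.s_eq b)).symm.bijective)

theorem HasChain.pull (E : Quiv.Equiv Q Q') (h : HasChain F Q') : HasChain F Q := by
  obtain ⟨W, f, hW, hf⟩ := h
  refine ⟨fun n => (W n).pull E, fun n => (f n).pull E, fun n => ⟨(hW n).1.pull E, (hW n).2.pull E⟩,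
    fun n => ⟨?_, fun hiso => (hf n).2 fun k => ?_⟩⟩
  · obtain ⟨k, hk⟩ := (hf n).1
    obtain ⟨k, rfl⟩ := E.v.surjective k
    exact ⟨k, hk⟩
  · obtain ⟨k, rfl⟩ := E.v.surjective k
    exact hiso k

end QRep

/-- The quiver obtained from the quiver with arrows `s, t : A₀ → V₀` by adding a sink `none` and
an arrow from `σ a` to it for every `a : A₁`. -/
abbrev Quiv.addSink {V₀ A₀ A₁ : Type} (s t : A₀ → V₀) (σ : A₁ → V₀) : Quiv where
  V := Option V₀
  A := A₀ ⊕ A₁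
  s := Sum.elim (fun a => some (s a)) fun a => some (σ a)
  t := Sum.elim (fun a => some (t a)) fun _ => none

/-- The quiver obtained from the quiver with arrows `s, t : A₀ → V₀` by adding a source `none` and
an arrow from it to `σ a` for every `a : A₁`. -/
abbrev Quiv.addSource {V₀ A₀ A₁ : Type} (s t : A₀ → V₀) (σ : A₁ → V₀) : Quiv where
  V := Option V₀
  A := A₀ ⊕ A₁
  s := Sum.elim (fun a => some (s a)) fun _ => none
  t := Sum.elim (fun a => some (t a)) fun a => some (σ a)

namespace QRep

variable {F : Type} [Field F] {V₀ A₀ A₁ : Type} {s t : A₀ → V₀} {σ : A₁ → V₀}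

/-- The vertex spaces of a representation of a quiver with an added vertex. -/
abbrev optM (M₀ : Type) (M : V₀ → Type) : Option V₀ → Type
  | none => M₀
  | some j => M j

instance optM.instAddCommGroup (M₀ : Type) (M : V₀ → Type) [AddCommGroup M₀]
    [∀ j, AddCommGroup (M j)] : ∀ j, AddCommGroup (optM M₀ M j)
  | none => inferInstanceAs (AddCommGroup M₀)
  | some j => inferInstanceAs (AddCommGroup (M j))

instance optM.instModule (M₀ : Type) (M : V₀ → Type) [AddCommGroup M₀]
    [∀ j, AddCommGroup (M j)] [Module F M₀] [∀ j, Module F (M j)] : ∀ j, Module F (optM M₀ M j)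
  | none => inferInstanceAs (Module F M₀)
  | some j => inferInstanceAs (Module F (M j))

section Constructors

variable (M₀ : Type) (M : V₀ → Type) [AddCommGroup M₀] [∀ j, AddCommGroup (M j)] [Module F M₀]
  [∀ j, Module F (M j)] (m : ∀ a, M (s a) →ₗ[F] M (t a))

/-- A representation of a quiver with an added sink. -/
def ofSink (p : ∀ a, M (σ a) →ₗ[F] M₀) : QRep F (Quiv.addSink s t σ) where
  M := optM M₀ M
  map
    | Sum.inl a => m a
    | Sum.inr a => p a

/-- A representation of a quiver with an added source. -/
def ofSource (p : ∀ a, M₀ →ₗ[F] M (σ a)) : QRep F (Quiv.addSource s t σ) where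
  M := optM M₀ M
  map
    | Sum.inl a => m a
    | Sum.inr a => p a

end Constructors

/-- The maps away from the added sink. -/
def sinkInner (X : QRep F (Quiv.addSink s t σ)) (a : A₀) :
    X.M (some (s a)) →ₗ[F] X.M (some (t a)) :=
  X.map (Sum.inl a)

/-- The maps away from the added source. -/
def sourceInner (Z : QRep F (Quiv.addSource s t σ)) (a : A₀) :
    Z.M (some (s a)) →ₗ[F] Z.M (some (t a)) :=
  Z.map (Sum.inl a)

/-- The maps into the added sink. -/
def inArm (X : QRep F (Quiv.addSink s t σ)) (a : A₁) : X.M (some (σ a)) →ₗ[F] X.M none :=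
  X.map (Sum.inr a)

/-- The maps out of the added source. -/
def outArm (Z : QRep F (Quiv.addSource s t σ)) (a : A₁) : Z.M none →ₗ[F] Z.M (some (σ a)) :=
  Z.map (Sum.inr a)

/-- The sum of the maps into the added sink. -/
def armSum [Fintype A₁] (X : QRep F (Quiv.addSink s t σ)) :
    (∀ a, X.M (some (σ a))) →ₗ[F] X.M none :=
  ∑ a, X.inArm a ∘ₗ LinearMap.proj a

theorem armSum_apply [Fintype A₁] (X : QRep F (Quiv.addSink s t σ)) (u : ∀ a, X.M (some (σ a))) :
    X.armSum u = ∑ a, X.inArm a (u a) := by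
  simp [armSum]

theorem Hom.sinkInner_comm {X Y : QRep F (Quiv.addSink s t σ)} (f : Hom X Y) (a : A₀)
    (x : X.M (some (s a))) :
    Y.sinkInner a (f.app (some (s a)) x) = f.app (some (t a)) (X.sinkInner a x) :=
  f.comm_apply (Sum.inl a) x

theorem Hom.sourceInner_comm {X Y : QRep F (Quiv.addSource s t σ)} (f : Hom X Y) (a : A₀)
    (x : X.M (some (s a))) :
    Y.sourceInner a (f.app (some (s a)) x) = f.app (some (t a)) (X.sourceInner a x) :=
  f.comm_apply (Sum.inl a) x

theorem Hom.inArm_comm {X Y : QRep F (Quiv.addSink s t σ)} (f : Hom X Y) (a : A₁)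
    (x : X.M (some (σ a))) :
    Y.inArm a (f.app (some (σ a)) x) = f.app none (X.inArm a x) :=
  f.comm_apply (Sum.inr a) x

theorem Hom.outArm_comm {X Y : QRep F (Quiv.addSource s t σ)} (f : Hom X Y) (a : A₁)
    (x : X.M none) :
    Y.outArm a (f.app none x) = f.app (some (σ a)) (X.outArm a x) :=
  f.comm_apply (Sum.inr a) x

theorem Hom.armSum_comm [Fintype A₁] {X Y : QRep F (Quiv.addSink s t σ)} (f : Hom X Y)
    (u : ∀ a, X.M (some (σ a))) :
    Y.armSum (fun a => f.app (some (σ a)) (u a)) = f.app none (X.armSum u) := by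
  simp only [armSum_apply, map_sum, f.inArm_comm]

/-- A morphism between representations of a quiver with an added sink. -/
def Hom.ofSink {X Y : QRep F (Quiv.addSink s t σ)} (f₀ : X.M none →ₗ[F] Y.M none)
    (f : ∀ j : V₀, X.M (some j) →ₗ[F] Y.M (some j))
    (hf : ∀ a x, Y.sinkInner a (f (s a) x) = f (t a) (X.sinkInner a x))
    (hf₀ : ∀ a x, Y.inArm a (f (σ a) x) = f₀ (X.inArm a x)) : Hom X Y where
  app
    | none => f₀
    | some j => f j
  comm
    | Sum.inl a => LinearMap.ext (hf a)
    | Sum.inr a => LinearMap.ext (hf₀ a)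

/-- A morphism between representations of a quiver with an added source. -/
def Hom.ofSource {X Y : QRep F (Quiv.addSource s t σ)} (f₀ : X.M none →ₗ[F] Y.M none)
    (f : ∀ j : V₀, X.M (some j) →ₗ[F] Y.M (some j))
    (hf : ∀ a x, Y.sourceInner a (f (s a) x) = f (t a) (X.sourceInner a x))
    (hf₀ : ∀ a x, Y.outArm a (f₀ x) = f (σ a) (X.outArm a x)) : Hom X Y where
  app
    | none => f₀
    | some j => f j
  comm
    | Sum.inl a => LinearMap.ext (hf a)
    | Sum.inr a => LinearMap.ext (hf₀ a)

/-- `X` and `Z` agree away from the added vertex, where they fit into a short exact sequence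
`0 → Z(none) → ∏ₐ X(σ a) → X(none) → 0`. -/
structure Reflects [Fintype A₁] (X : QRep F (Quiv.addSink s t σ))
    (Z : QRep F (Quiv.addSource s t σ)) where
  c : ∀ j : V₀, Z.M (some j) ≃ₗ[F] X.M (some j)
  comm : ∀ a z, X.sinkInner a (c (s a) z) = c (t a) (Z.sourceInner a z)
  inj : ∀ z, (∀ a, Z.outArm a z = 0) → z = 0
  surj : Function.Surjective X.armSum
  exact : ∀ u, X.armSum u = 0 ↔ ∃ z, ∀ a, c (σ a) (Z.outArm a z) = u a

namespace Reflects

variable [Fintype A₁] {X X' : QRep F (Quiv.addSink s t σ)} {Z Z' : QRep F (Quiv.addSource s t σ)}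

/-- Two morphisms correspond to each other if they agree away from the added vertex. -/
def Corr (R : Reflects X Z) (R' : Reflects X' Z') (f : Hom X X') (g : Hom Z Z') : Prop :=
  ∀ j z, R'.c j (g.app (some j) z) = f.app (some j) (R.c j z)

theorem exists_source_hom (R : Reflects X Z) (R' : Reflects X' Z') (f : Hom X X') :
    ∃ g, Corr R R' f g := by
  let φ : ∀ j, Z.M (some j) →ₗ[F] Z'.M (some j) := fun j =>
    (R'.c j).symm.toLinearMap ∘ₗ f.app (some j) ∘ₗ (R.c j).toLinearMap
  have hφ : ∀ j z, R'.c j (φ j z) = f.app (some j) (R.c j z) := fun j z =>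
    (R'.c j).apply_symm_apply _
  let Ψ : Z.M none →ₗ[F] ∀ a, Z'.M (some (σ a)) := LinearMap.pi fun a => φ (σ a) ∘ₗ Z.outArm a
  let Ψ' : Z'.M none →ₗ[F] ∀ a, Z'.M (some (σ a)) := LinearMap.pi Z'.outArm
  have hinj : LinearMap.ker Ψ' = ⊥ := by
    refine (Submodule.eq_bot_iff _).mpr fun z hz => R'.inj z fun a => congrFun hz a
  obtain ⟨r, hr⟩ := LinearMap.exists_leftInverse_of_injective Ψ' hinj
  have key : ∀ z, Ψ' (r (Ψ z)) = Ψ z := by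
    intro z
    have h0 : X'.armSum (fun a => f.app (some (σ a)) (R.c _ (Z.outArm a z))) = 0 := by
      rw [f.armSum_comm, (R.exact _).mpr ⟨z, fun a => rfl⟩, map_zero]
    obtain ⟨z', hz'⟩ := (R'.exact _).mp h0
    have : Ψ z = Ψ' z' := funext fun a => (R'.c _).injective ((hφ _ _).trans (hz' a).symm)
    rw [this, ← LinearMap.comp_apply r, hr, LinearMap.id_apply]
  refine ⟨Hom.ofSource (r ∘ₗ Ψ) φ (fun a z => (R'.c _).injective ?_)
    (fun a z => congrFun (key z) a), hφ⟩
  rw [← R'.comm, hφ, hφ, ← R.comm, f.sinkInner_comm]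

theorem exists_sink_hom (R : Reflects X Z) (R' : Reflects X' Z') (g : Hom Z Z') :
    ∃ f, Corr R R' f g := by
  let φ : ∀ j, X.M (some j) →ₗ[F] X'.M (some j) := fun j =>
    (R'.c j).toLinearMap ∘ₗ g.app (some j) ∘ₗ (R.c j).symm.toLinearMap
  have hφ : ∀ j z, R'.c j (g.app (some j) z) = φ j (R.c j z) := fun j z =>
    congrArg (fun w => R'.c j (g.app (some j) w)) ((R.c j).symm_apply_apply z).symm
  let P : (∀ a, X.M (some (σ a))) →ₗ[F] ∀ a, X'.M (some (σ a)) :=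
    LinearMap.pi fun a => φ (σ a) ∘ₗ LinearMap.proj a
  obtain ⟨r, hr⟩ := LinearMap.exists_rightInverse_of_surjective X.armSum
    (LinearMap.range_eq_top.mpr R.surj)
  have key : ∀ u, X'.armSum (P (r (X.armSum u))) = X'.armSum (P u) := by
    intro u
    rw [← sub_eq_zero, ← map_sub, ← map_sub]
    have h0 : X.armSum (r (X.armSum u) - u) = 0 := by
      rw [map_sub, ← LinearMap.comp_apply X.armSum r, hr, LinearMap.id_apply, sub_self]
    obtain ⟨z, hz⟩ := (R.exact _).mp h0
    refine (R'.exact _).mpr ⟨g.app none z, fun a => ?_⟩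
    rw [g.outArm_comm, hφ, hz]
    rfl
  refine ⟨Hom.ofSink (X'.armSum ∘ₗ P ∘ₗ r) φ (fun a x => ?_) (fun a x => ?_), hφ⟩
  · obtain ⟨z, rfl⟩ := (R.c _).surjective x
    rw [← hφ, R.comm, ← hφ, R'.comm, g.sourceInner_comm]
  · classical
    have h := key (Pi.single a x)
    have h1 : X.armSum (Pi.single a x) = X.inArm a x := by
      rw [armSum_apply, Finset.sum_eq_single a]
      · rw [Pi.single_eq_same]
      · intro b _ hb
        rw [Pi.single_eq_of_ne hb, map_zero]
      · simp
    have h2 : X'.armSum (P (Pi.single a x)) = X'.inArm a (φ _ x) := by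
      rw [armSum_apply, Finset.sum_eq_single a]
      · change X'.inArm a (φ (σ a) ((Pi.single a x : ∀ b, X.M (some (σ b))) a)) = _
        rw [Pi.single_eq_same]
      · intro b _ hb
        change X'.inArm b (φ (σ b) ((Pi.single a x : ∀ b, X.M (some (σ b))) b)) = _
        rw [Pi.single_eq_of_ne hb, map_zero, map_zero]
      · simp
    rw [h1, h2] at h
    exact h.symm

variable {R : Reflects X Z} {R' : Reflects X' Z'}

theorem Corr.sink_zero_iff {f : Hom X X'} {g : Hom Z Z'} (h : Corr R R' f g) :
    (∀ j x, f.app j x = 0) ↔ ∀ j z, g.app j z = 0 := by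
  constructor
  · intro hf
    have hs : ∀ j z, g.app (some j) z = 0 := fun j z =>
      (R'.c j).injective ((h j z).trans ((hf _ _).trans (map_zero _).symm))
    rintro (_ | j) z
    · exact R'.inj _ fun a => (g.outArm_comm a z).trans (hs _ _)
    · exact hs j z
  · intro hg
    have hs : ∀ j x, f.app (some j) x = 0 := fun j x => by
      obtain ⟨z, rfl⟩ := (R.c j).surjective x
      rw [← h, hg, map_zero]
    rintro (_ | j) x
    · obtain ⟨u, rfl⟩ := R.surj x
      have hu := f.armSum_comm u
      simp only [hs] at hu
      exact hu.symm.trans (map_zero _)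
    · exact hs j x

theorem Corr.id_iff {f : Hom X X} {g : Hom Z Z} (h : Corr R R f g) :
    (∀ j x, f.app j x = x) ↔ ∀ j z, g.app j z = z := by
  constructor
  · intro hf
    have hs : ∀ j z, g.app (some j) z = z := fun j z =>
      (R.c j).injective ((h j z).trans (hf _ _))
    rintro (_ | j) z
    · refine sub_eq_zero.mp (R.inj _ fun a => ?_)
      rw [map_sub, g.outArm_comm, hs, sub_self]
    · exact hs j z
  · intro hg
    have hs : ∀ j x, f.app (some j) x = x := fun j x => by
      obtain ⟨z, rfl⟩ := (R.c j).surjective x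
      rw [← h, hg]
    rintro (_ | j) x
    · obtain ⟨u, rfl⟩ := R.surj x
      have hu := f.armSum_comm u
      simp only [hs] at hu
      exact hu.symm
    · exact hs j x

theorem Corr.idem_iff {f : Hom X X} {g : Hom Z Z} (h : Corr R R f g) :
    (∀ j x, f.app j (f.app j x) = f.app j x) ↔ ∀ j z, g.app j (g.app j z) = g.app j z := by
  constructor
  · intro hf
    have hs : ∀ j z, g.app (some j) (g.app (some j) z) = g.app (some j) z := fun j z =>
      (R.c j).injective (by rw [h, h, hf])
    rintro (_ | j) z
    · refine sub_eq_zero.mp (R.inj _ fun a => ?_)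
      rw [map_sub, g.outArm_comm, g.outArm_comm, hs, sub_self]
    · exact hs j z
  · intro hg
    have hs : ∀ j x, f.app (some j) (f.app (some j) x) = f.app (some j) x := fun j x => by
      obtain ⟨z, rfl⟩ := (R.c j).surjective x
      rw [← h, ← h, hg]
    rintro (_ | j) x
    · obtain ⟨u, rfl⟩ := R.surj x
      simp only [← f.armSum_comm, hs]
    · exact hs j x

theorem Corr.isIso_iff {f : Hom X X'} {g : Hom Z Z'} (h : Corr R R' f g) :
    f.IsIso ↔ g.IsIso := by
  have hsome : ∀ j, Function.Bijective (f.app (some j)) ↔ Function.Bijective (g.app (some j)) := by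
    intro j
    have : ⇑(R'.c j) ∘ ⇑(g.app (some j)) = ⇑(f.app (some j)) ∘ ⇑(R.c j) := funext (h j)
    rw [← Function.Bijective.of_comp_iff _ (R.c j).bijective, ← this,
      Function.Bijective.of_comp_iff' (R'.c j).bijective]
  constructor
  · intro hf
    have hs := fun j => (hsome j).mp (hf (some j))
    rintro (_ | j)
    · refine ⟨(injective_iff_map_eq_zero _).mpr fun z hz => R.inj z fun a => ?_, fun z' => ?_⟩
      · apply (hs _).injective
        rw [← g.outArm_comm, hz, map_zero, map_zero]
      · choose u hu using fun a => (hf (some (σ a))).surjective (R'.c _ (Z'.outArm a z'))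
        have h0 : X.armSum u = 0 := by
          apply (hf none).injective
          rw [← f.armSum_comm, map_zero]
          simp only [hu]
          exact (R'.exact _).mpr ⟨z', fun _ => rfl⟩
        obtain ⟨z, hz⟩ := (R.exact _).mp h0
        refine ⟨z, sub_eq_zero.mp (R'.inj _ fun a => (R'.c _).injective ?_)⟩
        rw [map_sub, map_sub, g.outArm_comm, h, hz, hu, sub_self, map_zero]
    · exact hs j
  · intro hg
    have hs := fun j => (hsome j).mpr (hg (some j))
    rintro (_ | j)
    · refine ⟨(injective_iff_map_eq_zero _).mpr fun x hx => ?_, fun x' => ?_⟩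
      · obtain ⟨u, rfl⟩ := R.surj x
        rw [← f.armSum_comm] at hx
        obtain ⟨z', hz'⟩ := (R'.exact _).mp hx
        obtain ⟨z, rfl⟩ := (hg none).surjective z'
        refine (R.exact _).mpr ⟨z, fun a => (hs _).injective ?_⟩
        rw [← h, ← g.outArm_comm, hz']
      · obtain ⟨u', rfl⟩ := R'.surj x'
        choose u hu using fun a => (hs (σ a)).surjective (u' a)
        refine ⟨X.armSum u, ?_⟩
        rw [← f.armSum_comm]
        simp only [hu]
    · exact hs j

theorem nonzero_iff (R : Reflects X Z) : X.Nonzero ↔ Z.Nonzero := by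
  rw [← not_iff_not]
  simp only [Nonzero, not_exists, ne_eq, not_not]
  constructor
  · intro hX
    have hs : ∀ j, ∀ z : Z.M (some j), z = 0 := fun j z =>
      (R.c j).injective ((hX _ _).trans (map_zero _).symm)
    rintro (_ | j) z
    · exact R.inj z fun a => hs _ _
    · exact hs j z
  · intro hZ
    have hs : ∀ j, ∀ x : X.M (some j), x = 0 := fun j x =>
      (R.c j).symm.injective ((hZ _ _).trans (map_zero _).symm)
    rintro (_ | j) x
    · obtain ⟨u, rfl⟩ := R.surj x
      rw [show u = 0 from funext fun a => hs _ _, map_zero]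
    · exact hs j x

theorem indec_iff (R : Reflects X Z) : X.Indec ↔ Z.Indec := by
  rw [QRep.indec_iff, QRep.indec_iff, R.nonzero_iff]
  refine and_congr_right fun _ => ⟨fun h g hg => ?_, fun h f hf => ?_⟩
  · obtain ⟨f, hc⟩ := exists_sink_hom R R g
    rw [← hc.sink_zero_iff, ← hc.id_iff]
    exact h f (hc.idem_iff.mpr hg)
  · obtain ⟨g, hc⟩ := exists_source_hom R R f
    rw [hc.sink_zero_iff, hc.id_iff]
    exact h g (hc.idem_iff.mp hf)

theorem isFLEI_iff (R : Reflects X Z) : X.IsFLEI ↔ Z.IsFLEI := by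
  have hbij : ∀ a, Function.Bijective (X.map (Sum.inl a)) ↔
      Function.Bijective (Z.map (Sum.inl a)) := by
    intro a
    have : ⇑(X.sinkInner a) ∘ ⇑(R.c (s a)) = ⇑(R.c (t a)) ∘ ⇑(Z.sourceInner a) :=
      funext (R.comm a)
    change Function.Bijective (X.sinkInner a) ↔ Function.Bijective (Z.sourceInner a)
    rw [← Function.Bijective.of_comp_iff _ (R.c (s a)).bijective, this,
      Function.Bijective.of_comp_iff' (R.c (t a)).bijective]
  constructor
  · rintro ⟨hfin, hX⟩
    have hs : ∀ j, FiniteDimensional F (Z.M (some j)) := fun j =>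
      haveI := hfin (some j); (R.c j).symm.finiteDimensional
    refine ⟨?_, (hX.union (Set.finite_range Sum.inr)).subset ?_⟩
    · rintro (_ | j)
      · exact FiniteDimensional.of_injective (LinearMap.pi Z.outArm)
          ((injective_iff_map_eq_zero _).mpr fun z hz => R.inj z fun a => congrFun hz a)
      · exact hs j
    · rintro (a | a) ha
      · exact Or.inl fun h => ha ((hbij a).mp h)
      · exact Or.inr ⟨a, rfl⟩
  · rintro ⟨hfin, hZ⟩
    have hs : ∀ j, FiniteDimensional F (X.M (some j)) := fun j =>
      haveI := hfin (some j); (R.c j).finiteDimensional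
    refine ⟨?_, (hZ.union (Set.finite_range Sum.inr)).subset ?_⟩
    · rintro (_ | j)
      · exact Module.Finite.of_surjective X.armSum R.surj
      · exact hs j
    · rintro (a | a) ha
      · exact Or.inl fun h => ha ((hbij a).mpr h)
      · exact Or.inr ⟨a, rfl⟩

end Reflects

end QRep

namespace QRep

variable {F : Type} [Field F] {V₀ A₀ A₁ : Type} {s t : A₀ → V₀} {σ : A₁ → V₀}

theorem exists_reflects_of_surjective [Fintype A₁] (X : QRep F (Quiv.addSink s t σ))
    (hX : Function.Surjective X.armSum) :
    ∃ Z : QRep F (Quiv.addSource s t σ), Nonempty (Reflects X Z) :=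
  ⟨ofSource (LinearMap.ker X.armSum) (fun j => X.M (some j)) X.sinkInner
      fun a => (LinearMap.proj a : (∀ b, X.M (some (σ b))) →ₗ[F] X.M (some (σ a))) ∘ₗ
        (LinearMap.ker X.armSum).subtype,
    ⟨{ c := fun j => LinearEquiv.refl F (X.M (some j))
       comm := fun _ _ => rfl
       inj := fun _ hz => Subtype.ext (funext hz)
       surj := hX
       exact := fun u => ⟨fun hu => ⟨(⟨u, hu⟩ : LinearMap.ker X.armSum), fun _ => rfl⟩, by
        rintro ⟨z, hz⟩
        rw [← show z.1 = u from funext hz]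
        exact z.2⟩ }⟩⟩

theorem exists_reflects_of_injective [Fintype A₁] (Z : QRep F (Quiv.addSource s t σ))
    (hZ : ∀ z, (∀ a, Z.outArm a z = 0) → z = 0) :
    ∃ X : QRep F (Quiv.addSink s t σ), Nonempty (Reflects X Z) := by
  classical
  let I := LinearMap.range (LinearMap.pi Z.outArm)
  let X : QRep F (Quiv.addSink s t σ) :=
    ofSink ((∀ a, Z.M (some (σ a))) ⧸ I) (fun j => Z.M (some j)) Z.sourceInner
      fun a => I.mkQ ∘ₗ LinearMap.single F (fun a => Z.M (some (σ a))) a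
  have hsum : ∀ u : ∀ a, Z.M (some (σ a)), X.armSum u = I.mkQ u := by
    intro u
    refine (armSum_apply X u).trans ?_
    change ∑ a, I.mkQ (Pi.single a (u a)) = I.mkQ u
    rw [← map_sum, Finset.univ_sum_single]
  refine ⟨X, ⟨{ c := fun j => LinearEquiv.refl F (Z.M (some j))
                comm := fun _ _ => rfl
                inj := hZ
                surj := fun x => ?_
                exact := fun u => ?_ }⟩⟩
  · obtain ⟨u, hu⟩ := I.mkQ_surjective x
    exact ⟨u, (hsum u).trans hu⟩
  · refine Iff.trans (Eq.congr_left (hsum u)) ((Submodule.Quotient.mk_eq_zero I).trans ?_)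
    exact exists_congr fun z => funext_iff

theorem eq_smul_of_inArm_eq_zero {X : QRep F (Quiv.addSink s t σ)} (hX : X.IdemTrivial)
    (l : X.M none →ₗ[F] F) (x₀ : X.M none) (h₁ : l x₀ = 1) (hl : ∀ a x, l (X.inArm a x) = 0) :
    (∀ j (x : X.M (some j)), x = 0) ∧ ∀ x, x = l x • x₀ := by
  let e : Hom X X := Hom.ofSink (l.smulRight x₀) (fun _ => 0) (fun a x => by simp)
    fun a x => by simp [hl]
  have he : ∀ x, e.app none x = l x • x₀ := fun _ => rfl
  rcases hX e (by
    rintro (_ | j) x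
    · rw [he, he, map_smul, h₁, smul_eq_mul, mul_one]
    · rfl) with h | h
  · have h0 := h none x₀
    rw [he, h₁, one_smul] at h0
    rw [h0, map_zero] at h₁
    exact absurd h₁ zero_ne_one
  · exact ⟨fun j x => (h (some j) x).symm, fun x => (h none x).symm⟩

theorem eq_smul_of_outArm_eq_zero {Z : QRep F (Quiv.addSource s t σ)} (hZ : Z.IdemTrivial)
    (l : Z.M none →ₗ[F] F) (z₀ : Z.M none) (h₁ : l z₀ = 1) (h₀ : ∀ a, Z.outArm a z₀ = 0) :
    (∀ j (z : Z.M (some j)), z = 0) ∧ ∀ z, z = l z • z₀ := by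
  let e : Hom Z Z := Hom.ofSource (l.smulRight z₀) (fun _ => 0) (fun a z => by simp)
    fun a z => by simp [h₀]
  have he : ∀ z, e.app none z = l z • z₀ := fun _ => rfl
  rcases hZ e (by
    rintro (_ | j) z
    · rw [he, he, map_smul, h₁, smul_eq_mul, mul_one]
    · rfl) with h | h
  · have h0 := h none z₀
    rw [he, h₁, one_smul] at h0
    rw [h0, map_zero] at h₁
    exact absurd h₁ zero_ne_one
  · exact ⟨fun j z => (h (some j) z).symm, fun z => (h none z).symm⟩

theorem armSum_surjective_of_hom [Fintype A₁] {X Y : QRep F (Quiv.addSink s t σ)} (hX : X.Indec)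
    (hY : Y.Indec) (f : Hom X Y) (hf : f.Nonzero) (hiso : ¬ f.IsIso) :
    Function.Surjective Y.armSum := by
  classical
  rw [indec_iff] at hX hY
  by_contra hsurj
  rw [← LinearMap.range_eq_top] at hsurj
  obtain ⟨l, hl0, hl⟩ := Submodule.exists_le_ker_of_lt_top _ (lt_top_iff_ne_top.mpr hsurj)
  have hl' : ∀ a x, l (Y.inArm a x) = 0 := fun a x => hl ⟨Pi.single a x, by
    rw [armSum_apply, Finset.sum_eq_single a]
    · rw [Pi.single_eq_same]
    · intro b _ hb
      rw [Pi.single_eq_of_ne hb, map_zero]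
    · simp⟩
  obtain ⟨y, hy⟩ : ∃ y, l y ≠ 0 := by
    by_contra! h
    exact hl0 (LinearMap.ext h)
  obtain ⟨hYs, hYn⟩ := eq_smul_of_inArm_eq_zero hY.2 l ((l y)⁻¹ • y)
    (by rw [map_smul, smul_eq_mul, inv_mul_cancel₀ hy]) hl'
  set y₀ := (l y)⁻¹ • y
  obtain ⟨x, hx⟩ : ∃ x, f.app none x ≠ 0 := by
    obtain ⟨_ | j, hj⟩ := hf
    · by_contra! h
      exact hj (LinearMap.ext h)
    · exact absurd (LinearMap.ext fun x => hYs j _) hj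
  have hlx : l (f.app none x) ≠ 0 := fun h => hx (by rw [hYn (f.app none x), h, zero_smul])
  obtain ⟨hXs, hXn⟩ := eq_smul_of_inArm_eq_zero hX.2 (l ∘ₗ f.app none)
    ((l (f.app none x))⁻¹ • x)
    (by rw [map_smul, LinearMap.comp_apply, smul_eq_mul, inv_mul_cancel₀ hlx])
    fun a z => by rw [LinearMap.comp_apply, ← f.inArm_comm, hl']
  refine hiso ?_
  rintro (_ | j)
  · refine ⟨(injective_iff_map_eq_zero _).mpr fun z hz => ?_, fun z => ?_⟩
    · rw [hXn z, LinearMap.comp_apply, hz, map_zero, zero_smul]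
    · refine ⟨(l z * (l (f.app none x))⁻¹) • x, ?_⟩
      refine ((map_smul _ _ _).trans (congrArg _ (hYn (f.app none x)))).trans ?_
      rw [smul_smul, mul_assoc, inv_mul_cancel₀ hlx, mul_one, ← hYn]
  · exact ⟨fun z w _ => (hXs j z).trans (hXs j w).symm, fun z => ⟨0, (hYs j _).trans (hYs j _).symm⟩⟩

theorem outArm_injective_of_hom {X Y : QRep F (Quiv.addSource s t σ)} (hX : X.Indec)
    (hY : Y.Indec) (f : Hom X Y) (hf : f.Nonzero) (hiso : ¬ f.IsIso) (x₀ : X.M none)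
    (h₀ : ∀ a, X.outArm a x₀ = 0) : x₀ = 0 := by
  rw [indec_iff] at hX hY
  by_contra hx₀
  obtain ⟨l, hl⟩ := Module.Projective.exists_dual_eq_one F hx₀
  obtain ⟨hXs, hXn⟩ := eq_smul_of_outArm_eq_zero hX.2 l x₀ hl h₀
  have hy₀ : f.app none x₀ ≠ 0 := fun h => by
    obtain ⟨_ | j, hj⟩ := hf
    · refine hj (LinearMap.ext fun x => ?_)
      rw [hXn x, map_smul, h, smul_zero, LinearMap.zero_apply]
    · exact hj (LinearMap.ext fun x => by rw [hXs j x, map_zero, map_zero])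
  obtain ⟨m, hm⟩ := Module.Projective.exists_dual_eq_one F hy₀
  obtain ⟨hYs, hYn⟩ := eq_smul_of_outArm_eq_zero hY.2 m (f.app none x₀) hm fun a => by
    rw [f.outArm_comm, h₀, map_zero]
  refine hiso ?_
  rintro (_ | j)
  · refine ⟨(injective_iff_map_eq_zero _).mpr fun z hz => ?_, fun z => ?_⟩
    · rw [hXn z, map_smul, smul_eq_zero, or_iff_left hy₀] at hz
      rw [hXn z, hz, zero_smul]
    · refine ⟨m z • x₀, ?_⟩
      rw [map_smul, ← hYn]
  · exact ⟨fun z w _ => (hXs j z).trans (hXs j w).symm, fun z => ⟨0, (hYs j _).trans (hYs j _).symm⟩⟩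

theorem Hom.not_nonzero_iff {Q : Quiv} {X Y : QRep F Q} (f : Hom X Y) :
    ¬ f.Nonzero ↔ ∀ j x, f.app j x = 0 := by
  simp only [Hom.Nonzero, not_exists, not_not, LinearMap.ext_iff, LinearMap.zero_apply]

theorem HasChain.addSource_of_addSink [Finite A₁] (h : HasChain F (Quiv.addSink s t σ)) :
    HasChain F (Quiv.addSource s t σ) := by
  have := Fintype.ofFinite A₁
  obtain ⟨W, f, hW, hf⟩ := h
  choose Z hZ using fun n => exists_reflects_of_surjective (W (n + 1))
    (armSum_surjective_of_hom (hW n).1 (hW (n + 1)).1 (f n) (hf n).1 (hf n).2)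
  let R := fun n => (hZ n).some
  choose g hg using fun n => Reflects.exists_source_hom (R n) (R (n + 1)) (f (n + 1))
  refine ⟨Z, g, fun n => ⟨(R n).indec_iff.mp (hW _).1, (R n).isFLEI_iff.mp (hW _).2⟩,
    fun n => ⟨?_, mt (hg n).isIso_iff.mpr (hf (n + 1)).2⟩⟩
  by_contra hn
  rw [Hom.not_nonzero_iff, ← (hg n).sink_zero_iff, ← Hom.not_nonzero_iff] at hn
  exact hn (hf (n + 1)).1

theorem HasChain.addSink_of_addSource [Finite A₁] (h : HasChain F (Quiv.addSource s t σ)) :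
    HasChain F (Quiv.addSink s t σ) := by
  have := Fintype.ofFinite A₁
  obtain ⟨W, g, hW, hg⟩ := h
  choose X hX using fun n => exists_reflects_of_injective (W n)
    (outArm_injective_of_hom (hW n).1 (hW (n + 1)).1 (g n) (hg n).1 (hg n).2)
  let R := fun n => (hX n).some
  choose f hf using fun n => Reflects.exists_sink_hom (R n) (R (n + 1)) (g n)
  refine ⟨X, f, fun n => ⟨(R n).indec_iff.mpr (hW _).1, (R n).isFLEI_iff.mpr (hW _).2⟩,
    fun n => ⟨?_, mt (hf n).isIso_iff.mp (hg n).2⟩⟩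
  by_contra hn
  rw [Hom.not_nonzero_iff, (hf n).sink_zero_iff, ← Hom.not_nonzero_iff] at hn
  exact hn (hg n).1

end QRep

/-- Two vertices joined by an arrow. -/
def ArrowRel {V₀ A₀ : Type} (s t : A₀ → V₀) (x y : V₀) : Prop := ∃ a, s a = x ∧ t a = y

/-- The connected components of the quiver with arrows `s, t : A₀ → V₀`. -/
abbrev Comp {V₀ A₀ : Type} (s t : A₀ → V₀) : Type := Quot (ArrowRel s t)

/-- The connected component of a vertex. -/
abbrev comp {V₀ A₀ : Type} (s t : A₀ → V₀) (j : V₀) : Comp s t := Quot.mk _ j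

theorem comp_eq {V₀ A₀ : Type} (s t : A₀ → V₀) (a : A₀) : comp s t (s a) = comp s t (t a) :=
  Quot.sound ⟨a, rfl, rfl⟩

theorem comp_induction {V₀ A₀ : Type} {s t : A₀ → V₀} {P : V₀ → Prop}
    (hP : ∀ a, P (s a) ↔ P (t a)) {x y : V₀} (h : comp s t x = comp s t y) : P x ↔ P y := by
  have h' := Quot.eqvGen_exact h
  clear h
  induction h' with
  | rel x y h =>
    obtain ⟨a, rfl, rfl⟩ := h
    exact hP a
  | refl x => rfl
  | symm x y _ ih => exact ih.symm
  | trans x y z _ _ ih₁ ih₂ => exact ih₁.trans ih₂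

namespace QRep

variable {F : Type} [Field F] {V₀ A₀ A₁ : Type} {s t : A₀ → V₀} {σ : A₁ → V₀}
  {E : Type} [AddCommGroup E] [Module F E]

/-- The representation with `E` at the added sink and the subspace `u c` of `E` at all vertices of
the component `c`. -/
def subRep (σ : A₁ → V₀) (u : Comp s t → Submodule F E) : QRep F (Quiv.addSink s t σ) :=
  ofSink E (fun j => u (comp s t j))
    (fun a => (LinearEquiv.ofEq _ _ (congrArg u (comp_eq s t a))).toLinearMap)
    fun a => (u (comp s t (σ a))).subtype

/-- The representation with `E` at the added source and the quotient of `E` by `u c` at all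
vertices of the component `c`. -/
def quotRep (σ : A₁ → V₀) (u : Comp s t → Submodule F E) : QRep F (Quiv.addSource s t σ) :=
  ofSource E (fun j => E ⧸ u (comp s t j))
    (fun a => (Submodule.quotEquivOfEq _ _ (congrArg u (comp_eq s t a))).toLinearMap)
    fun a => (u (comp s t (σ a))).mkQ

/-- The morphism induced by a linear map respecting the subspaces. -/
def subHom {u u' : Comp s t → Submodule F E} (N : E →ₗ[F] E)
    (h : ∀ c, u c ≤ (u' c).comap N) : Hom (subRep σ u) (subRep σ u') :=
  Hom.ofSink N (fun j => N.restrict (h (comp s t j))) (fun _ _ => rfl) fun _ _ => rfl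

/-- The morphism induced by a linear map respecting the subspaces. -/
def quotHom {u u' : Comp s t → Submodule F E} (N : E →ₗ[F] E)
    (h : ∀ c, u c ≤ (u' c).comap N) : Hom (quotRep σ u) (quotRep σ u') :=
  Hom.ofSource N (fun j => Submodule.mapQ _ _ N (h (comp s t j)))
    (fun a x => by
      obtain ⟨x, rfl⟩ := Submodule.mkQ_surjective _ x
      rfl)
    fun _ _ => rfl

theorem subRep_isFLEI [FiniteDimensional F E] {u : Comp s t → Submodule F E}
    (hu : {a | u (comp s t (σ a)) ≠ ⊤}.Finite) : (subRep σ u).IsFLEI := by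
  refine ⟨?_, (hu.image Sum.inr).subset ?_⟩
  · rintro (_ | j)
    · exact inferInstanceAs (FiniteDimensional F E)
    · exact inferInstanceAs (FiniteDimensional F (u (comp s t j)))
  · rintro (a | a) ha
    · exact absurd (LinearEquiv.ofEq _ _ (congrArg u (comp_eq s t a))).bijective ha
    · refine ⟨a, fun h => ha ⟨Subtype.val_injective, fun x => ?_⟩, rfl⟩
      exact ⟨(⟨x, h.symm ▸ Submodule.mem_top⟩ : u (comp s t (σ a))), rfl⟩

theorem quotRep_isFLEI [FiniteDimensional F E] {u : Comp s t → Submodule F E}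
    (hu : {a | u (comp s t (σ a)) ≠ ⊥}.Finite) : (quotRep σ u).IsFLEI := by
  refine ⟨?_, (hu.image Sum.inr).subset ?_⟩
  · rintro (_ | j)
    · exact inferInstanceAs (FiniteDimensional F E)
    · exact inferInstanceAs (FiniteDimensional F (E ⧸ u (comp s t j)))
  · rintro (a | a) ha
    · exact absurd (Submodule.quotEquivOfEq _ _ (congrArg u (comp_eq s t a))).bijective ha
    · refine ⟨a, fun h => ha ⟨?_, Submodule.mkQ_surjective _⟩, rfl⟩
      refine LinearMap.ker_eq_bot.mp ?_
      exact (Submodule.ker_mkQ _).trans h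

theorem subRep_indec [Nontrivial E] {u : Comp s t → Submodule F E}
    (hbot : ∀ c, c ∉ Set.range (fun a => comp s t (σ a)) → u c = ⊥)
    (hu : ∀ T : E →ₗ[F] E, (∀ x, T (T x) = T x) →
      (∀ a, ∀ x ∈ u (comp s t (σ a)), T x ∈ u (comp s t (σ a))) →
      (∀ x, T x = 0) ∨ ∀ x, T x = x) :
    (subRep σ u).Indec := by
  refine (indec_iff _).mpr ⟨⟨none, exists_ne (0 : E)⟩, fun g hg => ?_⟩
  let T : E →ₗ[F] E := g.app none
  let G : ∀ j, u (comp s t j) →ₗ[F] u (comp s t j) := fun j => g.app (some j)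
  have hG : ∀ j x, (G j x : E) = T x := by
    intro j
    by_cases hj : comp s t j ∈ Set.range (fun a => comp s t (σ a))
    · obtain ⟨a, ha⟩ := hj
      refine (comp_induction (P := fun j => ∀ x, (G j x : E) = T x) (fun b => ?_) ha).mp
        (g.inArm_comm a)
      have hb : ∀ x, (G (s b) x : E) =
          G (t b) (LinearEquiv.ofEq _ _ (congrArg u (comp_eq s t b)) x) :=
        fun x => congrArg (fun z : u (comp s t (t b)) => (z : E)) (g.sinkInner_comm b x)
      refine ⟨fun h x => ?_, fun h x => (hb x).trans (h _)⟩
      obtain ⟨x, rfl⟩ := (LinearEquiv.ofEq _ _ (congrArg u (comp_eq s t b))).surjective x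
      exact (hb x).symm.trans (h x)
    · intro x
      have h0 : x = 0 := Subtype.ext ((Submodule.mem_bot F).mp (hbot _ hj ▸ x.2))
      rw [h0, map_zero, Submodule.coe_zero, map_zero]
  refine (hu T (hg none) fun a x hx => ?_).imp (fun h => ?_) (fun h => ?_)
  · rw [← hG (σ a) ⟨x, hx⟩]
    exact (G (σ a) ⟨x, hx⟩).2
  · rintro (_ | j) x
    · exact h x
    · exact Subtype.ext ((hG j x).trans (h _))
  · rintro (_ | j) x
    · exact h x
    · exact Subtype.ext ((hG j x).trans (h _))

theorem quotRep_indec [Nontrivial E] {u : Comp s t → Submodule F E}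
    (htop : ∀ c, c ∉ Set.range (fun a => comp s t (σ a)) → u c = ⊤)
    (hu : ∀ T : E →ₗ[F] E, (∀ x, T (T x) = T x) → (∀ x, T x = 0) ∨ ∀ x, T x = x) :
    (quotRep σ u).Indec := by
  refine (indec_iff _).mpr ⟨⟨none, exists_ne (0 : E)⟩, fun g hg => ?_⟩
  let T : E →ₗ[F] E := g.app none
  let G : ∀ j, E ⧸ u (comp s t j) →ₗ[F] E ⧸ u (comp s t j) := fun j => g.app (some j)
  have hG : ∀ j x, G j ((u (comp s t j)).mkQ x) = (u (comp s t j)).mkQ (T x) := by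
    intro j
    by_cases hj : comp s t j ∈ Set.range (fun a => comp s t (σ a))
    · obtain ⟨a, ha⟩ := hj
      refine (comp_induction
        (P := fun j => ∀ x, G j ((u (comp s t j)).mkQ x) = (u (comp s t j)).mkQ (T x))
        (fun b => forall_congr' fun x => ?_) ha).mp fun x => (g.outArm_comm a x).symm
      have hb : Submodule.quotEquivOfEq _ _ (congrArg u (comp_eq s t b))
          (G (s b) ((u (comp s t (s b))).mkQ x)) = G (t b) ((u (comp s t (t b))).mkQ x) :=
        g.sourceInner_comm b ((u (comp s t (s b))).mkQ x)
      rw [← hb, ← (Submodule.quotEquivOfEq _ _ (congrArg u (comp_eq s t b))).injective.eq_iff]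
      rfl
    · intro x
      have := Submodule.Quotient.subsingleton_iff.mpr (htop _ hj)
      exact Subsingleton.elim _ _
  refine (hu T (hg none)).imp (fun h => ?_) (fun h => ?_)
  · rintro (_ | j) x
    · exact h x
    · obtain ⟨x, rfl⟩ := Submodule.mkQ_surjective (u (comp s t j)) x
      exact (hG j x).trans (by rw [h, map_zero]; rfl)
  · rintro (_ | j) x
    · exact h x
    · obtain ⟨x, rfl⟩ := Submodule.mkQ_surjective (u (comp s t j)) x
      exact (hG j x).trans (by rw [h])

theorem hasChain_addSource [Infinite A₁] (hσ : Function.Injective fun a => comp s t (σ a)) :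
    HasChain F (Quiv.addSource s t σ) := by
  classical
  let arm := Infinite.natEmbedding A₁
  let u : ℕ → Comp s t → Submodule F F := fun n c =>
    if (∃ k < n, comp s t (σ (arm k)) = c) ∨ c ∉ Set.range (fun a => comp s t (σ a)) then ⊤ else ⊥
  have hmono : ∀ n c, u n c ≤ (u (n + 1) c).comap LinearMap.id := by
    intro n c
    rw [Submodule.comap_id]
    by_cases h : (∃ k < n, comp s t (σ (arm k)) = c) ∨ c ∉ Set.range (fun a => comp s t (σ a))
    · have h' : (∃ k < n + 1, comp s t (σ (arm k)) = c) ∨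
          c ∉ Set.range (fun a => comp s t (σ a)) :=
        h.imp_left fun ⟨k, hk, hc⟩ => ⟨k, hk.trans n.lt_succ_self, hc⟩
      simp only [u, if_pos h']
      exact le_top
    · simp only [u, if_neg h]
      exact bot_le
  refine ⟨fun n => quotRep σ (u n), fun n => quotHom LinearMap.id (hmono n),
    fun n => ⟨quotRep_indec (fun c hc => if_pos (Or.inr hc)) fun T hT => ?_, quotRep_isFLEI ?_⟩,
    fun n => ⟨⟨none, fun h => ?_⟩, fun h => ?_⟩⟩
  · have hmul : ∀ x, T x = x * T 1 := fun x => by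
      rw [← smul_eq_mul, ← map_smul, smul_eq_mul, mul_one]
    have h1 := hT 1
    rw [hmul (T 1)] at h1
    rcases (IsIdempotentElem.iff_eq_zero_or_one.mp h1) with h0 | h0
    · exact Or.inl fun x => by rw [hmul, h0, mul_zero]
    · exact Or.inr fun x => by rw [hmul, h0, mul_one]
  · refine ((Set.finite_lt_nat n).image arm).subset fun a ha => ?_
    by_contra hna
    refine ha (if_neg ?_)
    rintro (⟨k, hk, hc⟩ | hc)
    · exact hna ⟨k, hk, hσ hc⟩
    · exact hc ⟨a, rfl⟩
  · exact one_ne_zero (LinearMap.congr_fun (show (LinearMap.id : F →ₗ[F] F) = 0 from h) 1)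
  · have hinj := (h (some (σ (arm n)))).injective
    have htop : u (n + 1) (comp s t (σ (arm n))) = ⊤ :=
      if_pos (Or.inl ⟨n, n.lt_succ_self, rfl⟩)
    have hbot : u n (comp s t (σ (arm n))) = ⊥ := by
      refine if_neg ?_
      rintro (⟨k, hk, hc⟩ | hc)
      · exact hk.ne (arm.injective (hσ hc))
      · exact hc ⟨arm n, rfl⟩
    have := Submodule.Quotient.subsingleton_iff.mpr htop
    have h1 := @hinj (Submodule.Quotient.mk (1 : F) : F ⧸ u n (comp s t (σ (arm n))))
      (0 : F ⧸ u n (comp s t (σ (arm n))))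
      (Subsingleton.elim (α := F ⧸ u (n + 1) (comp s t (σ (arm n)))) _ _)
    have h2 := (Submodule.Quotient.mk_eq_zero _).mp h1
    rw [hbot] at h2
    exact one_ne_zero ((Submodule.mem_bot F).mp h2)

/-- Four subspaces of the plane for each parity, taking three distinct lines as values. -/
def fourLines (F : Type) [Field F] (n : ℕ) : ℕ → Submodule F (F × F)
  | 0 => LinearMap.ker (LinearMap.snd F F F)
  | 1 => LinearMap.ker (LinearMap.fst F F F)
  | 2 => if Even n then LinearMap.ker (LinearMap.fst F F F - LinearMap.snd F F F)
      else LinearMap.ker (LinearMap.fst F F F)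
  | 3 => if Even n then LinearMap.ker (LinearMap.snd F F F)
      else LinearMap.ker (LinearMap.fst F F F - LinearMap.snd F F F)
  | _ => ⊤

/-- The projection of the plane to an axis, depending on the parity of `n`. -/
def axisProj (F : Type) [Field F] (n : ℕ) : F × F →ₗ[F] F × F :=
  if Even n then LinearMap.inr F F F ∘ₗ LinearMap.snd F F F
  else LinearMap.inl F F F ∘ₗ LinearMap.fst F F F

theorem fourLines_le_comap (n k : ℕ) :
    fourLines F n k ≤ (fourLines F (n + 1) k).comap (axisProj F n) := by
  rintro ⟨x, y⟩ h
  by_cases hn : Even n <;> rcases k with _ | _ | _ | _ | k <;>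
    simp_all [fourLines, axisProj, Nat.even_add_one, -Nat.not_even_iff_odd]

theorem eq_zero_or_id_of_fourLines (n : ℕ) (T : F × F →ₗ[F] F × F) (hT : ∀ x, T (T x) = T x)
    (h : ∀ k, ∀ x ∈ fourLines F n k, T x ∈ fourLines F n k) :
    (∀ x, T x = 0) ∨ ∀ x, T x = x := by
  have h₁ : (T (1, 0)).2 = 0 := h 0 (1, 0) (by simp [fourLines])
  have h₂ : (T (0, 1)).1 = 0 := h 1 (0, 1) (by simp [fourLines])
  have h₃ : (T (1, 1)).1 = (T (1, 1)).2 := by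
    by_cases hn : Even n
    · have := h 2 (1, 1) (by simp [fourLines, hn])
      simpa [fourLines, hn, sub_eq_zero] using this
    · have := h 3 (1, 1) (by simp [fourLines, hn])
      simpa [fourLines, hn, sub_eq_zero] using this
  have hadd : T (1, 1) = T (1, 0) + T (0, 1) := by
    rw [← map_add, Prod.mk_add_mk, add_zero, zero_add]
  rw [hadd, Prod.fst_add, Prod.snd_add, h₁, h₂, add_zero, zero_add] at h₃
  have hsmul : ∀ x, T x = (T (1, 0)).1 • x := by
    rintro ⟨x, y⟩
    have : ((x, y) : F × F) = x • (1, 0) + y • (0, 1) := by simp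
    rw [this, map_add, map_smul, map_smul]
    ext
    · simp [h₂, mul_comm]
    · simp [h₁, ← h₃, mul_comm]
  generalize (T (1, 0)).1 = a at hsmul
  have ha := congrArg Prod.fst (hT (1, 0))
  simp only [hsmul, Prod.smul_fst, smul_eq_mul, mul_one] at ha
  rcases IsIdempotentElem.iff_eq_zero_or_one.mp ha with rfl | rfl
  · exact Or.inl fun x => by rw [hsmul, zero_smul]
  · exact Or.inr fun x => by rw [hsmul, one_smul]

theorem hasChain_addSink [Infinite A₁] (hσ : Function.Injective fun a => comp s t (σ a)) :
    HasChain F (Quiv.addSink s t σ) := by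
  classical
  let arm := Infinite.natEmbedding A₁
  have harm : Function.Injective fun k => comp s t (σ (arm k)) := hσ.comp arm.injective
  let dflt : Comp s t → Submodule F (F × F) := fun c =>
    if c ∈ Set.range (fun a => comp s t (σ a)) then ⊤ else ⊥
  let u : ℕ → Comp s t → Submodule F (F × F) := fun n =>
    Function.extend (fun k => comp s t (σ (arm k))) (fourLines F n) dflt
  have hu : ∀ n k, u n (comp s t (σ (arm k))) = fourLines F n k := fun n =>
    harm.extend_apply _ _
  have hu' : ∀ n c, (∀ k, comp s t (σ (arm k)) ≠ c) → u n c = dflt c := fun n c hc =>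
    Function.extend_apply' _ _ _ fun ⟨k, hk⟩ => hc k hk
  have hle : ∀ n c, u n c ≤ (u (n + 1) c).comap (axisProj F n) := by
    intro n c
    by_cases hc : ∃ k, comp s t (σ (arm k)) = c
    · obtain ⟨k, rfl⟩ := hc
      rw [hu, hu]
      exact fourLines_le_comap n k
    · push Not at hc
      rw [hu' n c hc, hu' (n + 1) c hc]
      by_cases h : c ∈ Set.range (fun a => comp s t (σ a))
      · simp only [dflt, if_pos h, Submodule.comap_top, le_refl]
      · simp only [dflt, if_neg h, bot_le]
  refine ⟨fun n => subRep σ (u n), fun n => subHom (axisProj F n) (hle n),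
    fun n => ⟨subRep_indec (fun c hc => ?_) fun T hT h => ?_, subRep_isFLEI ?_⟩,
    fun n => ⟨⟨none, fun h => ?_⟩, fun h => ?_⟩⟩
  · exact (hu' n c fun k hk => hc ⟨arm k, hk⟩).trans (if_neg hc)
  · refine eq_zero_or_id_of_fourLines n T hT fun k => ?_
    rw [← hu]
    exact h (arm k)
  · refine ((Set.finite_lt_nat 4).image arm).subset fun a ha => ?_
    by_contra hna
    refine ha ?_
    by_cases hk : ∃ k, arm k = a
    · obtain ⟨k, rfl⟩ := hk
      have hk4 : 4 ≤ k := not_lt.mp fun hk => hna ⟨k, hk, rfl⟩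
      obtain ⟨m, rfl⟩ := Nat.exists_eq_add_of_le' hk4
      rw [hu]
      rfl
    · exact (hu' n _ fun k hc => hk ⟨k, hσ hc⟩).trans (if_pos ⟨a, rfl⟩)
  · have h1 : axisProj F n (1, 1) = 0 := LinearMap.congr_fun h _
    by_cases hn : Even n <;> simp [axisProj, hn] at h1
  · have hinj : Function.Injective (axisProj F n) := (h none).injective
    by_cases hn : Even n
    · have := @hinj (1, 0) 0 (by simp [axisProj, hn])
      simp at this
    · have := @hinj (0, 1) 0 (by simp [axisProj, hn])
      simp at this

end QRep

theorem Quiv.ends_eq (Q : Quiv) (e : Q.A × Bool) :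
    Q.s e.1 = Q.esrc e ∧ Q.t e.1 = Q.etgt e ∨ Q.s e.1 = Q.etgt e ∧ Q.t e.1 = Q.esrc e := by
  obtain ⟨a, _ | _⟩ := e <;> simp [Quiv.esrc, Quiv.etgt]

/-- In a quiver without cycles, distinct arrows at a vertex `i` lead to distinct components of the
complement of `i`. -/
theorem Quiv.NoCycles.comp_ne {Q : Quiv} (hnc : Q.NoCycles) {i : Q.V} {A₀ : Type}
    {s t : A₀ → {j // j ≠ i}} (ι : A₀ → Q.A) (hs : ∀ a, Q.s (ι a) = s a)
    (ht : ∀ a, Q.t (ι a) = t a) {p q : Q.A × Bool} (hp : Q.esrc p = i) (hq : Q.etgt q = i)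
    (hpq : p.1 ≠ q.1) {x y : {j // j ≠ i}} (hx : Q.etgt p = x) (hy : Q.esrc q = y) :
    comp s t x ≠ comp s t y := by
  classical
  intro hxy
  let G : SimpleGraph {j // j ≠ i} := SimpleGraph.fromRel (ArrowRel s t)
  have hreach : G.Reachable x y := by
    refine (comp_induction (P := fun z => G.Reachable x z) (fun a => ?_) hxy).mp
      (SimpleGraph.Reachable.refl x)
    have hst : G.Reachable (s a) (t a) := by
      by_cases h : s a = t a
      · rw [h]
      · exact SimpleGraph.Adj.reachable
          ((SimpleGraph.fromRel_adj _ _ _).mpr ⟨h, Or.inl ⟨a, rfl, rfl⟩⟩)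
    exact ⟨fun h => h.trans hst, fun h => h.trans hst.symm⟩
  obtain ⟨w, hw⟩ := hreach.exists_isPath
  have hedge : ∀ k, ∃ e : Q.A × Bool, k < w.length →
      e.1 ∈ Set.range ι ∧ Q.esrc e = w.getVert k ∧ Q.etgt e = w.getVert (k + 1) := by
    intro k
    by_cases hk : k < w.length
    · rcases ((SimpleGraph.fromRel_adj _ _ _).mp (w.adj_getVert_succ hk)).2 with
        ⟨a, h₁, h₂⟩ | ⟨a, h₁, h₂⟩
      · exact ⟨(ι a, true), fun _ => ⟨⟨a, rfl⟩, by simp [Quiv.esrc, hs, h₁],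
          by simp [Quiv.etgt, ht, h₂]⟩⟩
      · exact ⟨(ι a, false), fun _ => ⟨⟨a, rfl⟩, by simp [Quiv.esrc, ht, h₂],
          by simp [Quiv.etgt, hs, h₁]⟩⟩
    · exact ⟨p, fun h => absurd h hk⟩
  choose d hd using hedge
  have hne : ∀ {b : Q.A}, b ∈ Set.range ι → Q.s b ≠ i ∧ Q.t b ≠ i := by
    rintro _ ⟨a, rfl⟩
    exact ⟨hs a ▸ (s a).2, ht a ▸ (t a).2⟩
  have hpd : ∀ k < w.length, p.1 ≠ (d k).1 := fun k hk h => by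
    have := hne (h ▸ (hd k hk).1)
    rcases Q.ends_eq p with h' | h'
    · exact this.1 (h'.1.trans hp)
    · exact this.2 (h'.2.trans hp)
  have hqd : ∀ k < w.length, q.1 ≠ (d k).1 := fun k hk h => by
    have := hne (h ▸ (hd k hk).1)
    rcases Q.ends_eq q with h' | h'
    · exact this.2 (h'.2.trans hq)
    · exact this.1 (h'.1.trans hq)
  have hdd : ∀ j < w.length, ∀ k < w.length, (d j).1 = (d k).1 → j = k := by
    intro j hj k hk h
    obtain ⟨-, hj₁, hj₂⟩ := hd j hj
    obtain ⟨-, hk₁, hk₂⟩ := hd k hk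
    have hinj : ∀ m ≤ w.length, ∀ n ≤ w.length,
        (w.getVert m : Q.V) = w.getVert n → m = n :=
      fun m hm n hn hmn => hw.getVert_injOn hm hn (Subtype.ext hmn)
    have e₁ := Q.ends_eq (d j)
    have e₂ := Q.ends_eq (d k)
    rw [← h, hk₁, hk₂] at e₂
    rw [hj₁, hj₂] at e₁
    rcases e₁ with ⟨a₁, b₁⟩ | ⟨a₁, b₁⟩ <;> rcases e₂ with ⟨a₂, b₂⟩ | ⟨a₂, b₂⟩
    · exact hinj _ hj.le _ hk.le (a₁.symm.trans a₂)
    · have h₁ := hinj _ hj.le _ hk (a₁.symm.trans a₂)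
      have h₂ := hinj _ hj _ hk.le (b₁.symm.trans b₂)
      omega
    · have h₁ := hinj _ hj _ hk.le (a₁.symm.trans a₂)
      have h₂ := hinj _ hj.le _ hk (b₁.symm.trans b₂)
      omega
    · exact hinj _ hj.le _ hk.le (b₁.symm.trans b₂)
  let e : ℕ → Q.A × Bool := fun
    | 0 => p
    | k + 1 => if k < w.length then d k else q
  have he : ∀ k < w.length, e (k + 1) = d k := fun k hk => if_pos hk
  have he' : e (w.length + 1) = q := if_neg (lt_irrefl _)
  have hsrc : ∀ k ≤ w.length, Q.esrc (e (k + 1)) = w.getVert k := by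
    intro k hk
    rcases hk.lt_or_eq with hk | rfl
    · rw [he k hk, (hd k hk).2.1]
    · rw [he', hy, w.getVert_length]
  refine hnc ⟨w.length + 2, e, by omega, ?_, ?_⟩
  · rintro (_ | k) hk
    · rw [Nat.mod_eq_of_lt (by omega), hsrc 0 (Nat.zero_le _), w.getVert_zero]
      exact hx
    · rcases (show k ≤ w.length by omega).lt_or_eq with hk | rfl
      · rw [Nat.mod_eq_of_lt (by omega), hsrc (k + 1) hk, he k hk, (hd k hk).2.2]
      · rw [Nat.mod_self, he', hq]
        exact hp.symm
  · have hlast : ∀ k < w.length + 2, k = 0 ∨ (∃ l < w.length, k = l + 1) ∨ k = w.length + 1 := by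
      rintro (_ | k) hk
      · exact Or.inl rfl
      · rcases (show k ≤ w.length by omega).lt_or_eq with hk | rfl
        · exact Or.inr (Or.inl ⟨k, hk, rfl⟩)
        · exact Or.inr (Or.inr rfl)
    intro j hj k hk h
    rcases hlast j hj with rfl | ⟨j, hj', rfl⟩ | rfl <;>
      rcases hlast k hk with rfl | ⟨k, hk', rfl⟩ | rfl
    · rfl
    · rw [he k hk'] at h
      exact absurd h (hpd k hk')
    · rw [he'] at h
      exact absurd h hpq
    · rw [he j hj'] at h
      exact absurd h.symm (hpd j hj')
    · rw [he j hj', he k hk'] at h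
      rw [hdd j hj' k hk' h]
    · rw [he', he j hj'] at h
      exact absurd h.symm (hqd j hj')
    · rw [he'] at h
      exact absurd h.symm hpq
    · rw [he', he k hk'] at h
      exact absurd h (hqd k hk')
    · rfl

/-- The inverse of an isomorphism of quivers. -/
def Quiv.Equiv.symm {Q Q' : Quiv} (E : Quiv.Equiv Q Q') : Quiv.Equiv Q' Q where
  v := E.v.symm
  a := E.a.symm
  s_eq b := by rw [Equiv.eq_symm_apply, ← E.s_eq, Equiv.apply_symm_apply]
  t_eq b := by rw [Equiv.eq_symm_apply, ← E.t_eq, Equiv.apply_symm_apply]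

namespace QRep

variable {F : Type} [Field F] {Q : Quiv} {i : Q.V}

theorem HasChain.sflip_of_isSink (hnc : Q.NoCycles) (hi : Q.IsSink i) (h : HasChain F Q) :
    HasChain F (Sflip Q i) := by
  classical
  let s : {a // ¬ Q.t a = i} → {j // j ≠ i} := fun a => ⟨Q.s a, hi a⟩
  let t : {a // ¬ Q.t a = i} → {j // j ≠ i} := fun a => ⟨Q.t a, a.2⟩
  let σ : {a // Q.t a = i} → {j // j ≠ i} := fun a => ⟨Q.s a, hi a⟩
  let E : Quiv.Equiv (Quiv.addSink s t σ) Q :=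
    { v := Equiv.optionSubtypeNe i
      a := (Equiv.sumComm _ _).trans (Equiv.sumCompl fun a => Q.t a = i)
      s_eq := by rintro (a | a) <;> rfl
      t_eq := by
        rintro (a | a)
        · rfl
        · exact a.2 }
  let E' : Quiv.Equiv (Quiv.addSource s t σ) (Sflip Q i) :=
    { v := Equiv.optionSubtypeNe i
      a := (Equiv.sumComm _ _).trans (Equiv.sumCompl fun a => Q.t a = i)
      s_eq := by
        rintro (a | a)
        · exact if_neg (not_or.mpr ⟨hi a, a.2⟩)
        · exact (if_pos (Or.inr a.2)).trans a.2
      t_eq := by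
        rintro (a | a)
        · exact if_neg (not_or.mpr ⟨hi a, a.2⟩)
        · exact if_pos (Or.inr a.2) }
  refine HasChain.pull E'.symm ?_
  rcases finite_or_infinite {a // Q.t a = i} with _ | _
  · exact (h.pull E).addSource_of_addSink
  · refine hasChain_addSource fun a b hab => ?_
    by_contra hne
    exact hnc.comp_ne (p := (a.1, false)) (q := (b.1, true)) Subtype.val (fun _ => rfl)
      (fun _ => rfl) a.2 b.2 (fun h => hne (Subtype.ext h)) rfl rfl hab

theorem HasChain.sflip_of_isSource (hnc : Q.NoCycles) (hi : Q.IsSource i) (h : HasChain F Q) :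
    HasChain F (Sflip Q i) := by
  classical
  let s : {a // ¬ Q.s a = i} → {j // j ≠ i} := fun a => ⟨Q.s a, a.2⟩
  let t : {a // ¬ Q.s a = i} → {j // j ≠ i} := fun a => ⟨Q.t a, hi a⟩
  let σ : {a // Q.s a = i} → {j // j ≠ i} := fun a => ⟨Q.t a, hi a⟩
  let E : Quiv.Equiv (Quiv.addSource s t σ) Q :=
    { v := Equiv.optionSubtypeNe i
      a := (Equiv.sumComm _ _).trans (Equiv.sumCompl fun a => Q.s a = i)
      s_eq := by
        rintro (a | a)
        · rfl
        · exact a.2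
      t_eq := by rintro (a | a) <;> rfl }
  let E' : Quiv.Equiv (Quiv.addSink s t σ) (Sflip Q i) :=
    { v := Equiv.optionSubtypeNe i
      a := (Equiv.sumComm _ _).trans (Equiv.sumCompl fun a => Q.s a = i)
      s_eq := by
        rintro (a | a)
        · exact if_neg (not_or.mpr ⟨a.2, hi a⟩)
        · exact if_pos (Or.inl a.2)
      t_eq := by
        rintro (a | a)
        · exact if_neg (not_or.mpr ⟨a.2, hi a⟩)
        · exact (if_pos (Or.inl a.2)).trans a.2 }
  refine HasChain.pull E'.symm ?_
  rcases finite_or_infinite {a // Q.s a = i} with _ | _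
  · exact (h.pull E).addSink_of_addSource
  · refine hasChain_addSink fun a b hab => ?_
    by_contra hne
    exact hnc.comp_ne (p := (a.1, true)) (q := (b.1, false)) Subtype.val (fun _ => rfl)
      (fun _ => rfl) a.2 b.2 (fun h => hne (Subtype.ext h)) rfl rfl hab

end QRep



/-- Let `i` be a source or a sink of a quiver `Ω` without cycles. If
`S_i(Ω)` admits no infinite sequence of indecomposable FLEI representations connected by
nonzero non-isomorphisms, then neither does `Ω`. -/
theorem stmt11 (F : Type) [Field F] (Q : Quiv) (hnc : Q.NoCycles)
    (i : Q.V) (hi : Q.IsSink i ∨ Q.IsSource i)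
    (h : ¬ ∃ (W : ℕ → QRep F (Sflip Q i)) (f : ∀ n : ℕ, QRep.Hom (W n) (W (n + 1))),
        (∀ n, (W n).Indec ∧ (W n).IsFLEI) ∧ (∀ n, (f n).Nonzero ∧ ¬ (f n).IsIso)) :
    ¬ ∃ (W : ℕ → QRep F Q) (f : ∀ n : ℕ, QRep.Hom (W n) (W (n + 1))),
        (∀ n, (W n).Indec ∧ (W n).IsFLEI) ∧ (∀ n, (f n).Nonzero ∧ ¬ (f n).IsIso) := by
  exact fun hQ => h (hi.elim (fun hi => QRep.HasChain.sflip_of_isSink hnc hi hQ)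
    fun hi => QRep.HasChain.sflip_of_isSource hnc hi hQ)
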